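/- Let n ≥ 2, ν ≥ 0, ρ₀ > 0, 1 ≤ N ≤ n/2, and let e_{1,1}, e_{1,2}, …, e_{N,1}, e_{N,2} ∈ ℝⁿ be 2N pairwise orthonormal vectors, spanning mutually orthogonal planes Sᵢ = span(e_{i,1}, e_{i,2}). For each 1 ≤ i ≤ N let λᵢ > 0, Mᵢ ≥ 1, and for 1 ≤ j ≤ Mᵢ let φ_{i,j}, β_{i,j}, δ_{i,j} ∈ ℝ; set k_{i,j} = λᵢ(cos φ_{i,j} e_{i,1} + sin φ_{i,j} e_{i,2}), a_{i,j} = λᵢ(−sin φ_{i,j} e_{i,1} + cos φ_{i,j} e_{i,2}), ψ_{i,j}(t,ξ) = β_{i,j} e^{−ν λᵢ² t} sin(ξ + δ_{i,j}); let c ∈ ℝⁿ and ω_{i,j} = c·k_{i,j}. Then the interacting transverse flow v(t,x) = Σ_{i=1}^N Σ_{j=1}^{Mᵢ} ψ_{i,j}(t, k_{i,j}·x − ω_{i,j}t) a_{i,j} + c together with the pressure p(t,x) = p̃(t) − ρ₀ h(t,x), where h(t,x) = Σ_{i=1}^N Σ_{j=1}^{Mᵢ} Σ_{ℓ=j+1}^{Mᵢ}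 ( (k_{i,j}·k_{i,ℓ}) ψ_{i,j} ψ_{i,ℓ} + λᵢ² ∂ξψ_{i,j} ∂ξψ_{i,ℓ} ) (all ψ's evaluated at their respective phases) and p̃ ∈ C(ℝ≥0, ℝ) is arbitrary, solves the incompressible Navier–Stokes equations on ℝⁿ. -/

import Mathlib

noncomputable section

open Real Finset

/-- Partial derivative of a scalar field in coordinate direction `j`. -/
def pd {n : ℕ} (f : (Fin n → ℝ) → ℝ) (j : Fin n) (x : Fin n → ℝ) : ℝ :=
  fderiv ℝ f x (Pi.single j 1)

/-- Euclidean dot product on `Fin n → ℝ`. -/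
def dot {n : ℕ} (a b : Fin n → ℝ) : ℝ := ∑ j, a j * b j

/-- Divergence of a vector field. -/
def vdiv {n : ℕ} (v : (Fin n → ℝ) → (Fin n → ℝ)) (x : Fin n → ℝ) : ℝ :=
  ∑ j, pd (fun y => v y j) j x

/-- Advective term `((u·∇)w) i = Σ_j u_j ∂w_i/∂x_j`. -/
def adv {n : ℕ} (u w : (Fin n → ℝ) → (Fin n → ℝ)) (x : Fin n → ℝ) (i : Fin n) : ℝ :=
  ∑ j, u x j * pd (fun y => w y i) j x

/-- Laplacian of a scalar field. -/
def lap {n : ℕ} (f : (Fin n → ℝ) → ℝ) (x : Fin n → ℝ) : ℝ :=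
  ∑ j, pd (fun y => pd f j y) j x

/-- The incompressible Navier–Stokes equations on ℝⁿ with viscosity `ν` and constant
density `ρ₀`: `∂t v + (v·∇)v = −(1/ρ₀)∇p + νΔv`, `∇·v = 0`, for `t ≥ 0`. -/
def IsNavierStokes (n : ℕ) (ν ρ₀ : ℝ) (v : ℝ → (Fin n → ℝ) → (Fin n → ℝ))
    (p : ℝ → (Fin n → ℝ) → ℝ) : Prop :=
  ∀ t, 0 ≤ t → ∀ x : Fin n → ℝ,
    (∀ i, deriv (fun s => v s x i) t + adv (v t) (v t) x i
        = -(1 / ρ₀) * pd (p t) i x + ν * lap (fun y => v t y i) x)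
    ∧ vdiv (v t) x = 0

lemma hasFDerivAt_dot {n : ℕ} (k x : Fin n → ℝ) :
    HasFDerivAt (dot k) (∑ j, k j • ContinuousLinearMap.proj (R := ℝ) (φ := fun _ : Fin n => ℝ) j)
      x := by
  have h : (dot k) =
      ⇑(∑ j, k j • ContinuousLinearMap.proj (R := ℝ) (φ := fun _ : Fin n => ℝ) j) := by
    funext y
    simp [dot]
  rw [h]
  exact ContinuousLinearMap.hasFDerivAt _

lemma dot_add_smul_single {n : ℕ} (k x : Fin n → ℝ) (m : Fin n) (s : ℝ) :
    dot k (x + s • Pi.single m 1) = dot k x + s * k m := by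
  simp [dot, mul_add, sum_add_distrib, Pi.single_apply, mul_comm]

/-- A partial derivative is the derivative along the corresponding coordinate line. -/
lemma pd_eq_of_hasDerivAt {n : ℕ} {f : (Fin n → ℝ) → ℝ} {m : Fin n} {x : Fin n → ℝ} {d : ℝ}
    (hf : DifferentiableAt ℝ f x)
    (h : HasDerivAt (fun s : ℝ => f (x + s • Pi.single m 1)) d 0) : pd f m x = d := by
  have h' : HasLineDerivAt ℝ f d x (Pi.single m 1) := h
  exact (hf.hasFDerivAt.hasLineDerivAt (Pi.single m 1)).unique h'

lemma hasDerivAt_wave_line {n : ℕ} {g : ℝ → ℝ} {g' : ℝ} (k x : Fin n → ℝ) (m : Fin n)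
    (hg : HasDerivAt g g' (dot k x)) :
    HasDerivAt (fun s : ℝ => g (dot k (x + s • Pi.single m 1))) (g' * k m) 0 := by
  simp only [dot_add_smul_single]
  have h : HasDerivAt (fun s : ℝ => dot k x + s * k m) (k m) 0 := by
    simpa using ((hasDerivAt_id (0 : ℝ)).mul_const (k m)).const_add (dot k x)
  exact HasDerivAt.comp (0 : ℝ) (h₂ := g) (by simpa using hg) h

lemma differentiableAt_wave {n : ℕ} {g : ℝ → ℝ} {g' : ℝ} (k x : Fin n → ℝ)
    (hg : HasDerivAt g g' (dot k x)) : DifferentiableAt ℝ (fun y => g (dot k y)) x :=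
  hg.differentiableAt.comp x (hasFDerivAt_dot k x).differentiableAt

/-- Partial derivatives of a finite superposition of plane waves. -/
lemma pd_sum_wave {n N : ℕ} {M : Fin N → ℕ} (k : (i : Fin N) → Fin (M i) → Fin n → ℝ)
    (g g' : (i : Fin N) → Fin (M i) → ℝ → ℝ) (hg : ∀ i j ξ, HasDerivAt (g i j) (g' i j ξ) ξ)
    (b : ℝ) (m : Fin n) (x : Fin n → ℝ) :
    pd (fun y => (∑ i, ∑ j, g i j (dot (k i j) y)) + b) m x
      = ∑ i, ∑ j, g' i j (dot (k i j) x) * k i j m := by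
  apply pd_eq_of_hasDerivAt
  · exact (DifferentiableAt.fun_sum fun i _ => DifferentiableAt.fun_sum fun j _ =>
      differentiableAt_wave _ _ (hg i j _)).add_const b
  · exact (HasDerivAt.fun_sum fun i _ => HasDerivAt.fun_sum fun j _ =>
      hasDerivAt_wave_line _ _ _ (hg i j _)).add_const b

/-- Partial derivatives of the pressure built from pairwise products of plane waves. -/
lemma pd_sum_wave_mul {n N : ℕ} {M : Fin N → ℕ} (k : (i : Fin N) → Fin (M i) → Fin n → ℝ)
    (f f' g g' : (i : Fin N) → Fin (M i) → ℝ → ℝ)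
    (hf : ∀ i j ξ, HasDerivAt (f i j) (f' i j ξ) ξ)
    (hg : ∀ i j ξ, HasDerivAt (g i j) (g' i j ξ) ξ)
    (q : (i : Fin N) → Fin (M i) → Fin (M i) → ℝ) (r : Fin N → ℝ) (b ρ : ℝ) (m : Fin n)
    (x : Fin n → ℝ) :
    pd (fun y => b - ρ * ∑ i, ∑ j, ∑ l ∈ Finset.Ioi j,
        (q i j l * f i j (dot (k i j) y) * f i l (dot (k i l) y)
          + r i * g i j (dot (k i j) y) * g i l (dot (k i l) y))) m x
      = -(ρ * ∑ i, ∑ j, ∑ l ∈ Finset.Ioi j,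
        (q i j l * (f' i j (dot (k i j) x) * k i j m * f i l (dot (k i l) x)
            + f i j (dot (k i j) x) * (f' i l (dot (k i l) x) * k i l m))
          + r i * (g' i j (dot (k i j) x) * k i j m * g i l (dot (k i l) x)
            + g i j (dot (k i j) x) * (g' i l (dot (k i l) x) * k i l m)))) := by
  simp only [mul_assoc (q _ _ _), mul_assoc (r _)]
  apply pd_eq_of_hasDerivAt
  · refine DifferentiableAt.const_sub (DifferentiableAt.const_mul
      (DifferentiableAt.fun_sum fun i _ => DifferentiableAt.fun_sum fun j _ =>
        DifferentiableAt.fun_sum fun l _ => ?_) _) _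
    exact (((differentiableAt_wave _ _ (hf i j _)).mul
        (differentiableAt_wave _ _ (hf i l _))).const_mul _).add
      (((differentiableAt_wave _ _ (hg i j _)).mul
        (differentiableAt_wave _ _ (hg i l _))).const_mul _)
  · refine HasDerivAt.const_sub _ (HasDerivAt.const_mul _
      (HasDerivAt.fun_sum fun i _ => HasDerivAt.fun_sum fun j _ =>
        HasDerivAt.fun_sum fun l _ => ?_))
    have h := (((hasDerivAt_wave_line (k i j) x m (hf i j _)).mul
        (hasDerivAt_wave_line (k i l) x m (hf i l _))).const_mul (q i j l)).add
      (((hasDerivAt_wave_line (k i j) x m (hg i j _)).mul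
        (hasDerivAt_wave_line (k i l) x m (hg i l _))).const_mul (r i))
    simpa [Pi.mul_def, Pi.add_def] using h

lemma dot_linearCombination {n : ℕ} (L p q L' p' q' : ℝ) (u v u' v' a b : Fin n → ℝ)
    (ha : ∀ d, a d = L * (p * u d + q * v d)) (hb : ∀ d, b d = L' * (p' * u' d + q' * v' d)) :
    dot a b = L * L' * (p * p' * dot u u' + p * q' * dot u v' + q * p' * dot v u'
      + q * q' * dot v v') := by
  simp only [dot, ha, hb, mul_sum, ← sum_add_distrib]
  exact sum_congr rfl fun d _ => by ring

/-- A double sum with vanishing diagonal, grouped into unordered pairs. -/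
lemma sum_sum_eq_sum_Ioi {M : ℕ} (F : Fin M → Fin M → ℝ) (hF : ∀ j, F j j = 0) :
    ∑ j, ∑ l, F j l = ∑ j, ∑ l ∈ Finset.Ioi j, (F j l + F l j) := by
  rw [sum_sum_Ioi_add_eq_sum_sum_off_diag fun j l => F l j]
  refine sum_congr rfl fun j _ => ?_
  rw [← sum_compl_add_sum {j} (F j), sum_singleton, hF, add_zero]


/-- In a plane with orthonormal frame `u, v`, the transverse direction of one wave vector,
weighted by the sine of the angle difference, in terms of the two wave vectors. -/
lemma sin_sub_mul_transverse (α γ u v : ℝ) :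
    Real.sin (γ - α) * (-Real.sin γ * u + Real.cos γ * v)
      = Real.cos (α - γ) * (Real.cos γ * u + Real.sin γ * v)
        - (Real.cos α * u + Real.sin α * v) := by
  rw [Real.sin_sub, Real.cos_sub]
  linear_combination
    (-(Real.cos α * u) - Real.sin α * v) * Real.sin_sq_add_cos_sq γ

/-- Interacting transverse flows. With `2N ≤ n` pairwise orthonormal vectors
`e_{i,1}, e_{i,2}` spanning mutually orthogonal planes, wave vectors
`k_{i,j} = λᵢ(cos φ_{i,j} e_{i,1} + sin φ_{i,j} e_{i,2})`, flow directions
`a_{i,j} = λᵢ(−sin φ_{i,j} e_{i,1} + cos φ_{i,j} e_{i,2})`, wave shapes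
`ψ_{i,j}(t,ξ) = β_{i,j} e^{−νλᵢ²t} sin(ξ + δ_{i,j})` and `ω_{i,j} = c·k_{i,j}`, the flow
`v = Σᵢ Σⱼ ψ_{i,j}(t, k_{i,j}·x − ω_{i,j}t) a_{i,j} + c` with pressure
`p = p̃(t) − ρ₀ h`, `h = Σᵢ Σⱼ Σ_{ℓ>j} ((k_{i,j}·k_{i,ℓ})ψ_{i,j}ψ_{i,ℓ}
+ λᵢ² ∂ξψ_{i,j} ∂ξψ_{i,ℓ})`, solves the Navier–Stokes equations on ℝⁿ. -/
theorem stmt16 (n N : ℕ) (hn : 2 ≤ n) (hN1 : 1 ≤ N) (hNn : 2 * N ≤ n)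
    (ν ρ₀ : ℝ) (hν : 0 ≤ ν) (hρ : 0 < ρ₀)
    (e : Fin N → Fin 2 → Fin n → ℝ)
    (he : ∀ i s i' s', dot (e i s) (e i' s') = if i = i' ∧ s = s' then 1 else 0)
    (lam : Fin N → ℝ) (hlam : ∀ i, 0 < lam i)
    (M : Fin N → ℕ) (hM : ∀ i, 1 ≤ M i)
    (φ β δ : (i : Fin N) → Fin (M i) → ℝ) (c : Fin n → ℝ)
    (k a : (i : Fin N) → Fin (M i) → Fin n → ℝ)
    (hk : ∀ i j d, k i j d
      = lam i * (Real.cos (φ i j) * e i 0 d + Real.sin (φ i j) * e i 1 d))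
    (ha : ∀ i j d, a i j d
      = lam i * (-Real.sin (φ i j) * e i 0 d + Real.cos (φ i j) * e i 1 d))
    (ψ : (i : Fin N) → Fin (M i) → ℝ → ℝ → ℝ)
    (hψ : ∀ i j t ξ, ψ i j t ξ = β i j * Real.exp (-ν * lam i ^ 2 * t) * Real.sin (ξ + δ i j))
    (ω : (i : Fin N) → Fin (M i) → ℝ) (hω : ∀ i j, ω i j = dot c (k i j))
    (ptil : ℝ → ℝ) :
    IsNavierStokes n ν ρ₀
      (fun t x d => (∑ i, ∑ j, ψ i j t (dot (k i j) x - ω i j * t) * a i j d) + c d)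
      (fun t x => ptil t - ρ₀ * ∑ i, ∑ j, ∑ l ∈ Finset.Ioi j,
          (dot (k i j) (k i l) * ψ i j t (dot (k i j) x - ω i j * t)
              * ψ i l t (dot (k i l) x - ω i l * t)
           + lam i ^ 2
              * (β i j * Real.exp (-ν * lam i ^ 2 * t)
                  * Real.cos (dot (k i j) x - ω i j * t + δ i j))
              * (β i l * Real.exp (-ν * lam i ^ 2 * t)
                  * Real.cos (dot (k i l) x - ω i l * t + δ i l)))) := by
  have hdot : ∀ i i' (p q p' q' L L' : ℝ) (u w : Fin n → ℝ),
      (∀ d, u d = L * (p * e i 0 d + q * e i 1 d)) →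
      (∀ d, w d = L' * (p' * e i' 0 d + q' * e i' 1 d)) →
      dot u w = if i = i' then L * L' * (p * p' + q * q') else 0 := by
    intro i i' p q p' q' L L' u w hu hw
    rw [dot_linearCombination _ _ _ _ _ _ _ _ _ _ _ _ hu hw]
    by_cases h : i = i' <;> simp [he, h]
  have hkk : ∀ i j l, dot (k i j) (k i l) = lam i ^ 2 * Real.cos (φ i j - φ i l) := by
    intro i j l
    rw [hdot i i _ _ _ _ _ _ _ _ (hk i j) (hk i l), if_pos rfl, Real.cos_sub]
    ring
  have hak : ∀ i j i' l, dot (a i j) (k i' l)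
      = if i = i' then lam i * lam i' * (-Real.sin (φ i j) * Real.cos (φ i' l)
          + Real.cos (φ i j) * Real.sin (φ i' l)) else 0 := fun i j i' l =>
    hdot i i' _ _ _ _ _ _ _ _ (ha i j) (hk i' l)
  have hak' : ∀ i j l, dot (a i j) (k i l) = lam i ^ 2 * Real.sin (φ i l - φ i j) := by
    intro i j l
    rw [hak, if_pos rfl, Real.sin_sub]
    ring
  intro t _ x
  simp only [hψ]
  set B : (i : Fin N) → Fin (M i) → ℝ := fun i j => β i j * Real.exp (-ν * lam i ^ 2 * t) with hB
  set S : (i : Fin N) → Fin (M i) → ℝ :=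
    fun i j => B i j * Real.sin (dot (k i j) x - ω i j * t + δ i j) with hS
  set C : (i : Fin N) → Fin (M i) → ℝ :=
    fun i j => B i j * Real.cos (dot (k i j) x - ω i j * t + δ i j) with hC
  have hphase : ∀ i j ξ, HasDerivAt (fun ξ => ξ - ω i j * t + δ i j) 1 ξ := fun i j ξ =>
    ((hasDerivAt_id ξ).sub_const _).add_const _
  have hsin : ∀ i j ξ, HasDerivAt (fun ξ => B i j * Real.sin (ξ - ω i j * t + δ i j))
      (B i j * Real.cos (ξ - ω i j * t + δ i j)) ξ := fun i j ξ => by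
    simpa using (hphase i j ξ).sin.const_mul (B i j)
  have hcos : ∀ i j ξ, HasDerivAt (fun ξ => B i j * Real.cos (ξ - ω i j * t + δ i j))
      (-(B i j * Real.sin (ξ - ω i j * t + δ i j))) ξ := fun i j ξ => by
    simpa using (hphase i j ξ).cos.const_mul (B i j)
  have hpd : ∀ d m y, pd (fun y => (∑ i, ∑ j,
        B i j * Real.sin (dot (k i j) y - ω i j * t + δ i j) * a i j d) + c d) m y
      = ∑ i, ∑ j, B i j * Real.cos (dot (k i j) y - ω i j * t + δ i j) * a i j d * k i j m :=
    fun d m y => pd_sum_wave k _ _ (fun i j ξ => (hsin i j ξ).mul_const (a i j d)) (c d) m y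
  have hpd2 : ∀ d m, pd (fun y => ∑ i, ∑ j,
        B i j * Real.cos (dot (k i j) y - ω i j * t + δ i j) * a i j d * k i j m) m x
      = ∑ i, ∑ j, -S i j * a i j d * k i j m * k i j m := fun d m => by
    simpa using pd_sum_wave k _ _
      (fun i j ξ => ((hcos i j ξ).mul_const (a i j d)).mul_const (k i j m)) 0 m x
  have htime : ∀ d, deriv (fun s => (∑ i, ∑ j, β i j * Real.exp (-ν * lam i ^ 2 * s)
        * Real.sin (dot (k i j) x - ω i j * s + δ i j) * a i j d) + c d) t
      = ∑ i, ∑ j, (-ν * lam i ^ 2 * S i j - ω i j * C i j) * a i j d := by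
    intro d
    apply HasDerivAt.deriv
    refine (HasDerivAt.fun_sum fun i _ => HasDerivAt.fun_sum fun j _ =>
      HasDerivAt.mul_const ?_ _).add_const _
    have h1 : HasDerivAt (fun s => -ν * lam i ^ 2 * s) (-ν * lam i ^ 2) t := by
      simpa only [id, mul_one] using (hasDerivAt_id t).const_mul (-ν * lam i ^ 2)
    have h2 : HasDerivAt (fun s => dot (k i j) x - ω i j * s + δ i j) (-ω i j) t := by
      simpa using (((hasDerivAt_id t).const_mul (ω i j)).const_sub (dot (k i j) x)).add_const (δ i j)
    refine ((h1.exp.const_mul (β i j)).mul h2.sin).congr_deriv ?_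
    simp only [hS, hC, hB]
    ring
  have hlap : ∀ d, lap (fun y => (∑ i, ∑ j,
        B i j * Real.sin (dot (k i j) y - ω i j * t + δ i j) * a i j d) + c d) x
      = ∑ i, ∑ j, -(lam i ^ 2) * S i j * a i j d := by
    intro d
    simp only [lap, hpd, hpd2]
    rw [sum_comm]
    refine sum_congr rfl fun i _ => ?_
    rw [sum_comm]
    refine sum_congr rfl fun j _ => ?_
    have h := hkk i j j
    rw [sub_self, Real.cos_zero, mul_one, dot] at h
    rw [← h, ← sum_neg_distrib, sum_mul, sum_mul]
    exact sum_congr rfl fun m _ => by ring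
  have hadv : ∀ d, adv
        (fun y d => (∑ i, ∑ j,
          B i j * Real.sin (dot (k i j) y - ω i j * t + δ i j) * a i j d) + c d)
        (fun y d => (∑ i, ∑ j,
          B i j * Real.sin (dot (k i j) y - ω i j * t + δ i j) * a i j d) + c d) x d
      = ∑ i, ∑ l, C i l * a i l d * ((∑ j, S i j * dot (a i j) (k i l)) + ω i l) := by
    intro d
    have h : ∀ i l, (∑ m, ((∑ i, ∑ j, S i j * a i j m) + c m) * k i l m)
        = (∑ j, S i j * dot (a i j) (k i l)) + ω i l := by
      intro i l
      simp only [add_mul, sum_add_distrib, hω, dot]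
      congr 1
      simp only [sum_mul]
      rw [sum_comm, sum_eq_single i]
      · rw [sum_comm]
        refine sum_congr rfl fun j _ => ?_
        rw [mul_sum]
        exact sum_congr rfl fun m _ => by ring
      · intro i' _ hne
        rw [sum_comm]
        refine sum_eq_zero fun j _ => ?_
        have h0 := hak i' j i l
        rw [if_neg hne, dot] at h0
        simp only [mul_assoc, ← mul_sum, h0, mul_zero]
      · simp
    simp only [adv, hpd, ← h, mul_sum]
    rw [sum_comm]
    refine sum_congr rfl fun i _ => ?_
    rw [sum_comm]
    exact sum_congr rfl fun l _ => sum_congr rfl fun m _ => by ring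
  refine ⟨fun d => ?_, ?_⟩
  · have hp := pd_sum_wave_mul k _ _ _ _ hsin hcos (fun i j l => dot (k i j) (k i l))
      (fun i => lam i ^ 2) (ptil t) ρ₀ d x
    refine (congrArg₂ (· + ·) (htime d) (hadv d)).trans
      (Eq.trans ?_ (congrArg₂ (fun u w => -(1 / ρ₀) * u + ν * w) hp (hlap d)).symm)
    rw [neg_mul_neg, ← mul_assoc, one_div_mul_cancel hρ.ne', one_mul, mul_sum,
      ← sum_add_distrib, ← sum_add_distrib]
    refine sum_congr rfl fun i _ => ?_
    have hpair : ∑ j, ∑ l ∈ Finset.Ioi j,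
        (dot (k i j) (k i l) * (C i j * k i j d * S i l + S i j * (C i l * k i l d))
          + lam i ^ 2 * (-S i j * k i j d * C i l + C i j * (-S i l * k i l d)))
        = ∑ j, ∑ l, S i j * C i l * (dot (a i j) (k i l) * a i l d) := by
      rw [sum_sum_eq_sum_Ioi _ fun j => by simp [hak']]
      refine sum_congr rfl fun j _ => sum_congr rfl fun l _ => ?_
      have h1 := sin_sub_mul_transverse (φ i j) (φ i l) (e i 0 d) (e i 1 d)
      have h2 := sin_sub_mul_transverse (φ i l) (φ i j) (e i 0 d) (e i 1 d)
      rw [← neg_sub (φ i j) (φ i l), Real.cos_neg] at h2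
      simp only [hkk, hak', hk, ha]
      linear_combination -(lam i ^ 3 * S i j * C i l) * h1 - lam i ^ 3 * S i l * C i j * h2
    refine Eq.trans ?_ (congrArg (· + _) hpair.symm)
    rw [sum_comm (f := fun j l => S i j * C i l * _), mul_sum, ← sum_add_distrib,
      ← sum_add_distrib]
    refine sum_congr rfl fun l _ => ?_
    have hl : ∑ j, S i j * C i l * (dot (a i j) (k i l) * a i l d)
        = C i l * a i l d * ∑ j, S i j * dot (a i j) (k i l) := by
      rw [mul_sum]
      exact sum_congr rfl fun j _ => by ring
    rw [hl]
    ring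
  · refine (sum_congr rfl fun m _ => hpd m m x).trans ?_
    rw [sum_comm]
    refine sum_eq_zero fun i _ => ?_
    rw [sum_comm]
    refine sum_eq_zero fun j _ => ?_
    have h := hak' i j j
    rw [sub_self, Real.sin_zero, mul_zero, dot] at h
    simp only [mul_assoc, ← mul_sum, h, mul_zero]
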